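/- Let Q be a finite set and let E = Q^n be equipped with the Hamming distance. For any m ≥ 2 and any points x_1, …, x_m ∈ E, the convex hull satisfies the recursion hull(x_1,…,x_m) = ⋃_{x ∈ hull(x_1,…,x_{m−1})} [x, x_m], and hull(x_1) = {x_1}. -/

import Mathlib

variable {Q : Type*} [Fintype Q] [DecidableEq Q] {n : ℕ}

/-- The metric segment `[x,y]` in the Hamming space `Q^n`. -/
def hammingSeg (x y : Fin n → Q) : Set (Fin n → Q) :=
  {z | hammingDist x y = hammingDist x z + hammingDist z y}

/-- A subset `K ⊆ Q^n` is convex (for the Hamming metric) if it contains the segment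
between any two of its points. -/
def HammingConvex (K : Set (Fin n → Q)) : Prop :=
  ∀ x ∈ K, ∀ y ∈ K, hammingSeg x y ⊆ K

/-- The convex hull of `S ⊆ Q^n`: the smallest Hamming-convex set containing `S`. -/
def hammingHull (S : Set (Fin n → Q)) : Set (Fin n → Q) :=
  ⋂₀ {K : Set (Fin n → Q) | HammingConvex K ∧ S ⊆ K}

omit [Fintype Q] in
/-- The segment between two points of `Q^n` is the product of the pairs of their coordinates. -/
theorem mem_hammingSeg_iff {x y z : Fin n → Q} :
    z ∈ hammingSeg x y ↔ ∀ i, z i = x i ∨ z i = y i := by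
  have hle : ∀ i ∈ (Finset.univ : Finset (Fin n)), (if x i ≠ y i then 1 else 0) ≤
      (if x i ≠ z i then 1 else 0) + (if z i ≠ y i then 1 else 0) := by
    intro i _
    grind
  simp only [hammingSeg, Set.mem_ofPred_eq, hammingDist, Finset.card_filter,
    ← Finset.sum_add_distrib]
  rw [Finset.sum_eq_sum_iff_of_le hle]
  refine ⟨fun h i => ?_, fun h i _ => ?_⟩
  · have := h i (Finset.mem_univ i)
    grind
  · have := h i
    grind

omit [Fintype Q] in
/-- The Hamming hull of a nonempty set is the product of its coordinate projections. -/
theorem mem_hammingHull_iff {S : Set (Fin n → Q)} (hS : S.Nonempty) {z : Fin n → Q} :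
    z ∈ hammingHull S ↔ ∀ i, ∃ s ∈ S, z i = s i := by
  constructor
  · intro h
    refine h {w | ∀ i, ∃ s ∈ S, w i = s i} ⟨fun x hx y hy w hw i => ?_, fun s hs i => ⟨s, hs, rfl⟩⟩
    rcases mem_hammingSeg_iff.1 hw i with h | h
    · rw [h]; exact hx i
    · rw [h]; exact hy i
  · rintro h K ⟨hK, hSK⟩
    have agree : ∀ T : Finset (Fin n), ∃ k ∈ K, ∀ i ∈ T, k i = z i := by
      intro T
      induction T using Finset.induction_on with
      | empty =>
        obtain ⟨s, hs⟩ := hS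
        exact ⟨s, hSK hs, by simp⟩
      | insert i T _ ih =>
        obtain ⟨k, hk, hkz⟩ := ih
        obtain ⟨s, hs, hsz⟩ := h i
        refine ⟨Function.update k i (z i), hK k hk s (hSK hs) (mem_hammingSeg_iff.2 fun j => ?_),
          fun j hj => ?_⟩
        · by_cases hji : j = i
          · subst hji; simp [hsz]
          · simp [hji]
        · by_cases hji : j = i
          · subst hji; simp
          · simpa [hji] using hkz j (Finset.mem_of_mem_insert_of_ne hj hji)
    obtain ⟨k, hk, hkz⟩ := agree Finset.univ
    rwa [← funext fun i => hkz i (Finset.mem_univ i)]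

/-- Property (P2) in the Hamming space `Q^n`: `hull(x₁) = {x₁}`, and for `m ≥ 2`
(here points are indexed by `Fin (m+1)` with `1 ≤ m`, so there are `m + 1 ≥ 2` of them),
`hull(x₁,…,xₘ₊₁) = ⋃_{x ∈ hull(x₁,…,xₘ)} [x, xₘ₊₁]`. -/
theorem hammingHull_recursion :
    (∀ a : Fin n → Q, hammingHull {a} = {a}) ∧
    (∀ m : ℕ, 1 ≤ m → ∀ x : Fin (m + 1) → Fin n → Q,
      hammingHull (Set.range x) =
        ⋃ z ∈ hammingHull (Set.range fun j : Fin m => x j.castSucc),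
          hammingSeg z (x (Fin.last m))) := by
  constructor
  · intro a
    ext z
    rw [mem_hammingHull_iff (Set.singleton_nonempty a)]
    simp [← funext_iff]
  · intro m hm x
    have : Nonempty (Fin m) := ⟨⟨0, hm⟩⟩
    ext z
    simp only [mem_hammingHull_iff (Set.range_nonempty _), Set.mem_iUnion, exists_prop,
      Set.exists_range_iff, mem_hammingSeg_iff]
    constructor
    · intro h
      have coord : ∀ i, ∃ q, (∃ j : Fin m, q = x j.castSucc i) ∧
          (z i = q ∨ z i = x (Fin.last m) i) := by
        intro i
        obtain ⟨j, hj⟩ := h i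
        induction j using Fin.lastCases with
        | last => exact ⟨_, ⟨⟨0, hm⟩, rfl⟩, Or.inr hj⟩
        | cast j => exact ⟨_, ⟨j, hj⟩, Or.inl rfl⟩
      choose w hw hz using coord
      exact ⟨w, hw, hz⟩
    · rintro ⟨w, hw, hz⟩ i
      rcases hz i with h | h
      · obtain ⟨j, hj⟩ := hw i
        exact ⟨j.castSucc, h.trans hj⟩
      · exact ⟨Fin.last m, h⟩
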